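/- arXiv:2404.06384 — 2 statements merged into one kernel-verified Lean document; each statement's English description precedes it below -/
import Mathlib

section
/- Let ε, γ ∈ ℂ, let K be the pair K¹ = B₃[u] + 2ε D_x(v₂ + 3u v₁ + 2v u₁ + 2u²v), K² = v₃ + 3u v₂ + 6u₁v₁ + 3u²v₁ − ε(4v v₂ − v₁² + 8u₁v² + 8uv v₁ + 4u²v²), and let τ = (1/6)[−(x²u₁ + 2xu − 1, x²v₁ + 2xv + γ), K]. Then for every n ≥ 0 the iterated adjoint ad_τⁿ K = [τ,[τ,…,[τ,K]…]] (n brackets) is a pair of differential polynomials of order exactly 3 + 2n, i.e. it depends on the variables u_{3+2n}, v_{3+2n} but on no u_k, v_k with k > 3+2n. (This is proved by induction on n.) -/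
open MvPolynomial

/-- The two-component differential ring `𝒜₂ = ℂ[x, u₀, u₁, …, v₀, v₁, …]`:
variable `none` is `x`, `some (false, k)` is `u_k`, `some (true, k)` is `v_k`. -/
abbrev A2 : Type := MvPolynomial (Option (Bool × ℕ)) ℂ

/-- The variable `x`. -/
noncomputable def Xx : A2 := X none

/-- The variable `u_k`. -/
noncomputable def U (k : ℕ) : A2 := X (some (false, k))

/-- The variable `v_k`. -/
noncomputable def V (k : ℕ) : A2 := X (some (true, k))

/-- The total derivative `D_x = ∂/∂x + Σ_{k≥0} (u_{k+1} ∂/∂u_k + v_{k+1} ∂/∂v_k)`. -/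
noncomputable def Dx (P : A2) : A2 :=
  pderiv (none : Option (Bool × ℕ)) P +
    ∑ᶠ k : ℕ, (U (k + 1) * pderiv (some (false, k)) P +
      V (k + 1) * pderiv (some (true, k)) P)

/-- `frU P Q = P_{u*}(Q) = Σ_k (∂P/∂u_k) D_x^k(Q)`. -/
noncomputable def frU (P Q : A2) : A2 :=
  ∑ᶠ k : ℕ, pderiv (some (false, k)) P * Dx^[k] Q

/-- `frV P Q = P_{v*}(Q) = Σ_k (∂P/∂v_k) D_x^k(Q)`. -/
noncomputable def frV (P Q : A2) : A2 :=
  ∑ᶠ k : ℕ, pderiv (some (true, k)) P * Dx^[k] Q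

/-- The Lie bracket of two pairs (evolutionary vector fields). -/
noncomputable def lieBr2 (P J : A2 × A2) : A2 × A2 :=
  (frU J.1 P.1 + frV J.1 P.2 - frU P.1 J.1 - frV P.1 J.2,
   frU J.2 P.1 + frV J.2 P.2 - frU P.2 J.1 - frV P.2 J.2)

/-- The third-order Burgers flow `B₃[u] = u₃ + 3u u₂ + 3u² u₁ + 3u₁²`. -/
noncomputable def B3 : A2 := U 3 + 3 * U 0 * U 2 + 3 * U 0 ^ 2 * U 1 + 3 * U 1 ^ 2

/-- The partial derivative with respect to `u_k` (for `b = false`) or `v_k` (for `b = true`). -/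
noncomputable abbrev pd (b : Bool) (k : ℕ) : Derivation ℂ A2 A2 := pderiv (some (b, k))

/-- The total derivative as a bundled derivation. -/
noncomputable def totalDerivation : Derivation ℂ A2 A2 :=
  mkDerivation ℂ fun i : Option (Bool × ℕ) => i.elim 1 fun w => X (some (w.1, w.2 + 1))

/-- `Σ_k (∂P/∂w_k) D_x^k(Q)`, where `w` is the dependent variable selected by `b`. -/
noncomputable def frechet (b : Bool) (P Q : A2) : A2 :=
  ∑ᶠ k : ℕ, pd b k P * Dx^[k] Q

/-- `P` involves no derivative of order larger than `p` of the variable selected by `b`. -/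
def OrderLE (b : Bool) (p : ℕ) (P : A2) : Prop := ∀ k, p < k → pd b k P = 0

theorem exists_forall_mem_vars_lt (P : A2) :
    ∃ N : ℕ, ∀ b k, some (b, k) ∈ P.vars → k < N := by
  refine ⟨P.vars.sup (fun i => i.elim 0 fun w => w.2) + 1, fun b k h => ?_⟩
  have := Finset.le_sup (f := fun i : Option (Bool × ℕ) => i.elim 0 fun w => w.2) h
  exact Nat.lt_succ_of_le this

theorem Dx_eq_totalDerivation (P : A2) : Dx P = totalDerivation P := by
  obtain ⟨N, hN⟩ := exists_forall_mem_vars_lt P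
  have h0 : ∀ b k, N ≤ k → pderiv (some (b, k)) P = 0 := fun b k hk =>
    pderiv_eq_zero_of_notMem_vars fun h => by have := hN b k h; omega
  let E : Derivation ℂ A2 A2 := pderiv none +
    ∑ k ∈ Finset.range N, (U (k + 1) • pd false k + V (k + 1) • pd true k)
  have hE : ∀ Q, E Q = pderiv none Q + ∑ k ∈ Finset.range N,
      (U (k + 1) * pd false k Q + V (k + 1) * pd true k Q) := by
    intro Q
    simp only [E, Derivation.add_apply, ← Derivation.coeFnAddMonoidHom_apply, map_sum,
      Finset.sum_apply]
    simp [Derivation.coeFnAddMonoidHom_apply]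
  have h1 : Dx P = E P := by
    rw [hE, Dx, finsum_eq_sum_of_support_subset (s := Finset.range N)]
    intro k hk
    by_contra hk'
    have hk' : N ≤ k := by simpa using hk'
    exact hk (by simp [h0 _ k hk'])
  rw [h1]
  refine derivation_eq_of_forall_mem_vars fun i hi => ?_
  rw [hE]
  rcases i with _ | ⟨_ | _, k⟩
  · simp [totalDerivation, pderiv_X]
  · have := hN _ _ hi
    simp [totalDerivation, pderiv_X, Pi.single_apply, U, this]
  · have := hN _ _ hi
    simp [totalDerivation, pderiv_X, Pi.single_apply, V, this]

theorem pd_comm (a b : Bool) (j k : ℕ) (P : A2) : pd a j (pd b k P) = pd b k (pd a j P) := by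
  have : ⁅pd a j, pd b k⁆ = 0 := by
    refine derivation_ext fun i => ?_
    simp only [Derivation.commutator_apply, pderiv_X, Pi.single_apply]
    split_ifs <;> simp
  have := Derivation.congr_fun this P
  rwa [Derivation.commutator_apply, Derivation.zero_apply, sub_eq_zero] at this

theorem pd_succ_Dx (b : Bool) (k : ℕ) (P : A2) :
    pd b (k + 1) (Dx P) = Dx (pd b (k + 1) P) + pd b k P := by
  have : ⁅pd b (k + 1), totalDerivation⁆ = pd b k := by
    refine derivation_ext fun i => ?_
    rcases i with _ | ⟨a, j⟩ <;>
    simp only [Derivation.commutator_apply, pderiv_X, Pi.single_apply, totalDerivation,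
      mkDerivation_X] <;>
    simp [pderiv_X, Pi.single_apply, apply_ite]
  have := Derivation.congr_fun this P
  rw [Derivation.commutator_apply] at this
  simp only [Dx_eq_totalDerivation]
  linear_combination this

theorem Dx_zero : Dx 0 = 0 := by simp [Dx_eq_totalDerivation]

theorem Dx_C (c : ℂ) : Dx (C c) = 0 := by
  rw [Dx_eq_totalDerivation]; exact Derivation.map_algebraMap _ c

theorem OrderLE.iterate_Dx {b : Bool} {p : ℕ} {P : A2} (h : OrderLE b p P) (j : ℕ) :
    OrderLE b (p + j) (Dx^[j] P) := by
  induction j with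
  | zero => exact h
  | succ j ih =>
    rintro (_ | k) hk
    · omega
    · rw [Function.iterate_succ_apply', pd_succ_Dx, ih _ (by omega), ih _ (by omega), Dx_zero,
        add_zero]

theorem OrderLE.pd_iterate_Dx_top {b : Bool} {p : ℕ} {P : A2} (h : OrderLE b p P) (j : ℕ) :
    pd b (p + j) (Dx^[j] P) = pd b p P := by
  induction j with
  | zero => rfl
  | succ j ih =>
    rw [Function.iterate_succ_apply', ← add_assoc, pd_succ_Dx, ih, h.iterate_Dx j _ (by omega),
      Dx_zero, zero_add]

theorem OrderLE.pd_iterate_Dx_subtop {b : Bool} {q : ℕ} {P : A2} (h : OrderLE b (q + 1) P)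
    (j : ℕ) : pd b (q + j) (Dx^[j] P) = pd b q P + j * Dx (pd b (q + 1) P) := by
  induction j with
  | zero => simp
  | succ j ih =>
    rw [Function.iterate_succ_apply', ← add_assoc, pd_succ_Dx, ih,
      show q + j + 1 = q + 1 + j by ring, h.pd_iterate_Dx_top]
    push_cast
    ring

theorem pd_iterate_Dx_eq_zero {b : Bool} {P : A2} (h : ∀ k, pd b k P = 0) (j k : ℕ) :
    pd b k (Dx^[j] P) = 0 := by
  induction j generalizing k with
  | zero => exact h k
  | succ j ih =>
    rw [Function.iterate_succ_apply']
    rcases k with _ | k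
    · have : ⁅pd b 0, totalDerivation⁆ = 0 := by
        refine derivation_ext fun i => ?_
        rcases i with _ | ⟨a, i⟩ <;>
        simp only [Derivation.commutator_apply, pderiv_X, Pi.single_apply, totalDerivation,
          mkDerivation_X] <;>
        simp [pderiv_X, apply_ite]
      have := Derivation.congr_fun this (Dx^[j] P)
      rw [Derivation.commutator_apply, ih] at this
      rw [Dx_eq_totalDerivation]
      simpa using this
    · rw [pd_succ_Dx, ih, ih, Dx_zero, add_zero]

theorem frechet_eq_sum {a : Bool} {r : ℕ} {J : A2} (h : OrderLE a r J) (P : A2) :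
    frechet a J P = ∑ j ∈ Finset.range (r + 1), pd a j J * Dx^[j] P := by
  refine finsum_eq_sum_of_support_subset _ fun k hk => ?_
  by_contra hk'
  have hk' : r < k := by simpa using hk'
  exact hk (by simp [h k hk'])

theorem frechet_eq_zero {a : Bool} {J : A2} (h : ∀ k, pd a k J = 0) (P : A2) :
    frechet a J P = 0 := by
  simp [frechet, h]

theorem pd_frechet {a b : Bool} {r k : ℕ} {J : A2} (hJ : OrderLE a r J)
    (hk : ∃ c, pd b k J = C c) (P : A2) :
    pd b k (frechet a J P) = ∑ j ∈ Finset.range (r + 1), pd a j J * pd b k (Dx^[j] P) := by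
  obtain ⟨c, hc⟩ := hk
  rw [frechet_eq_sum hJ, map_sum]
  refine Finset.sum_congr rfl fun j _ => ?_
  rw [Derivation.leibniz, pd_comm, hc]
  simp

theorem pd_frechet_eq_zero {a b : Bool} {r k : ℕ} {J P : A2} (hJ : OrderLE a r J)
    (hk : ∃ c, pd b k J = C c) (hP : ∀ k, pd b k P = 0) : pd b k (frechet a J P) = 0 := by
  rw [pd_frechet hJ hk]
  exact Finset.sum_eq_zero fun j _ => by rw [pd_iterate_Dx_eq_zero hP, mul_zero]

theorem pd_frechet_of_lt {a b : Bool} {r p k : ℕ} {J P : A2} (hJ : OrderLE a r J)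
    (hk : ∃ c, pd b k J = C c) (hP : OrderLE b p P) (h : r + p < k) :
    pd b k (frechet a J P) = 0 := by
  rw [pd_frechet hJ hk]
  refine Finset.sum_eq_zero fun j hj => ?_
  rw [Finset.mem_range] at hj
  rw [hP.iterate_Dx j k (by omega), mul_zero]

theorem pd_frechet_top {a b : Bool} {r p k : ℕ} {J P : A2} (hJ : OrderLE a r J)
    (hk : ∃ c, pd b k J = C c) (hP : OrderLE b p P) (h : k = r + p) :
    pd b k (frechet a J P) = pd a r J * pd b p P := by
  rw [pd_frechet hJ hk, Finset.sum_range_succ, Finset.sum_eq_zero, zero_add, h, add_comm r p,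
    hP.pd_iterate_Dx_top]
  intro j hj
  rw [Finset.mem_range] at hj
  rw [hP.iterate_Dx j k (by omega), mul_zero]

theorem pd_frechet_subtop {a b : Bool} {r p k : ℕ} {J P : A2} (hJ : OrderLE a (r + 1) J)
    (hk : ∃ c, pd b k J = C c) (hP : OrderLE b (p + 1) P) (h : k = r + p + 1) :
    pd b k (frechet a J P) =
      pd a (r + 1) J * (pd b p P + (r + 1 : ℕ) * Dx (pd b (p + 1) P)) +
        pd a r J * pd b (p + 1) P := by
  rw [pd_frechet hJ hk, Finset.sum_range_succ, Finset.sum_range_succ, Finset.sum_eq_zero,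
    zero_add, h, show r + p + 1 = p + 1 + r by ring, hP.pd_iterate_Dx_top,
    show p + 1 + r = p + (r + 1) by ring, hP.pd_iterate_Dx_subtop, add_comm]
  intro j hj
  rw [Finset.mem_range] at hj
  rw [hP.iterate_Dx j k (by omega), mul_zero]

theorem OrderLE.exists_C {b : Bool} {p k : ℕ} {P : A2} (h : OrderLE b p P) (hk : p < k) :
    ∃ c, pd b k P = C c := ⟨0, by rw [h k hk, map_zero]⟩

theorem lieBr2_fst (P J : A2 × A2) : (lieBr2 P J).1 = frechet false J.1 P.1 +
    frechet true J.1 P.2 - frechet false P.1 J.1 - frechet true P.1 J.2 := rfl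

theorem lieBr2_snd (P J : A2 × A2) : (lieBr2 P J).2 = frechet false J.2 P.1 +
    frechet true J.2 P.2 - frechet false P.2 J.1 - frechet true P.2 J.2 := rfl

/-- The pair `S` has order at most `l + 3`, and up to terms of lower order its linearisation is
upper triangular with diagonal entries `c`. -/
structure IsTriangular (l : ℕ) (c : A2) (S : A2 × A2) : Prop where
  orderLE_uu : OrderLE false (l + 3) S.1
  orderLE_uv : OrderLE true (l + 3) S.1
  orderLE_vu : OrderLE false (l + 1) S.2
  orderLE_vv : OrderLE true (l + 3) S.2
  pd_uu : pd false (l + 3) S.1 = c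
  pd_vv : pd true (l + 3) S.2 = c

theorem Dx_neg_Xx : Dx (-Xx) = -1 := by
  simp [Dx_eq_totalDerivation, totalDerivation, Xx]

theorem IsTriangular.lieBr2 {T S : A2 × A2} {c : ℂ} {l : ℕ} (hT : IsTriangular 0 (-Xx) T)
    (hS : IsTriangular l (C c) S) :
    IsTriangular (l + 2) (C (-(l + 3) * c)) (lieBr2 T S) := by
  obtain ⟨t1, t2, t3, t4, t5, t6⟩ := hT
  obtain ⟨s1, s2, s3, s4, s5, s6⟩ := hS
  simp only [zero_add] at t1 t2 t3 t4 t5 t6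
  have cast_eq : C (-(l + 3) * c) = -((l : A2) + 3) * C c := by
    have : C (3 : ℂ) = (3 : A2) := map_ofNat C 3
    simp [this]
  constructor
  · intro k hk
    rw [lieBr2_fst, map_sub, map_sub, map_add,
      pd_frechet_of_lt s2 (s1.exists_C (by omega)) t3 (by omega),
      pd_frechet_of_lt t2 (t1.exists_C (by omega)) s3 (by omega)]
    rcases (show l + 6 = k ∨ l + 6 < k by omega) with rfl | hk
    · rw [pd_frechet_top s1 (s1.exists_C (by omega)) t1 (by omega),
        pd_frechet_top t1 (t1.exists_C (by omega)) s1 (by omega)]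
      ring
    · rw [pd_frechet_of_lt s1 (s1.exists_C (by omega)) t1 (by omega),
        pd_frechet_of_lt t1 (t1.exists_C (by omega)) s1 (by omega)]
      ring
  · intro k hk
    rw [lieBr2_fst, map_sub, map_sub, map_add]
    rcases (show l + 6 = k ∨ l + 6 < k by omega) with rfl | hk
    · rw [pd_frechet_top s1 (s2.exists_C (by omega)) t2 (by omega),
        pd_frechet_top s2 (s2.exists_C (by omega)) t4 (by omega),
        pd_frechet_top t1 (t2.exists_C (by omega)) s2 (by omega),
        pd_frechet_top t2 (t2.exists_C (by omega)) s4 (by omega), s5, s6, t5, t6]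
      ring
    · rw [pd_frechet_of_lt s1 (s2.exists_C (by omega)) t2 (by omega),
        pd_frechet_of_lt s2 (s2.exists_C (by omega)) t4 (by omega),
        pd_frechet_of_lt t1 (t2.exists_C (by omega)) s2 (by omega),
        pd_frechet_of_lt t2 (t2.exists_C (by omega)) s4 (by omega)]
      ring
  · intro k hk
    rw [lieBr2_snd, map_sub, map_sub, map_add]
    rcases (show l + 4 = k ∨ l + 4 < k by omega) with rfl | hk
    · rw [pd_frechet_top s3 (s3.exists_C (by omega)) t1 (by omega),
        pd_frechet_top s4 (s3.exists_C (by omega)) t3 (by omega),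
        pd_frechet_top t3 (t3.exists_C (by omega)) s1 (by omega),
        pd_frechet_top t4 (t3.exists_C (by omega)) s3 (by omega), s5, s6, t5, t6]
      ring
    · rw [pd_frechet_of_lt s3 (s3.exists_C (by omega)) t1 (by omega),
        pd_frechet_of_lt s4 (s3.exists_C (by omega)) t3 (by omega),
        pd_frechet_of_lt t3 (t3.exists_C (by omega)) s1 (by omega),
        pd_frechet_of_lt t4 (t3.exists_C (by omega)) s3 (by omega)]
      ring
  · intro k hk
    rw [lieBr2_snd, map_sub, map_sub, map_add,
      pd_frechet_of_lt s3 (s4.exists_C (by omega)) t2 (by omega),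
      pd_frechet_of_lt t3 (t4.exists_C (by omega)) s2 (by omega)]
    rcases (show l + 6 = k ∨ l + 6 < k by omega) with rfl | hk
    · rw [pd_frechet_top s4 (s4.exists_C (by omega)) t4 (by omega),
        pd_frechet_top t4 (t4.exists_C (by omega)) s4 (by omega)]
      ring
    · rw [pd_frechet_of_lt s4 (s4.exists_C (by omega)) t4 (by omega),
        pd_frechet_of_lt t4 (t4.exists_C (by omega)) s4 (by omega)]
      ring
  · rw [lieBr2_fst, map_sub, map_sub, map_add,
      pd_frechet_of_lt s2 (s1.exists_C (by omega)) t3 (by omega),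
      pd_frechet_of_lt t2 (t1.exists_C (by omega)) s3 (by omega),
      pd_frechet_subtop s1 (s1.exists_C (by omega)) t1 (by omega),
      pd_frechet_subtop t1 (t1.exists_C (by omega)) s1 (by omega), s5, t5, Dx_C, Dx_neg_Xx,
      cast_eq]
    push_cast
    ring
  · rw [lieBr2_snd, map_sub, map_sub, map_add,
      pd_frechet_of_lt s3 (s4.exists_C (by omega)) t2 (by omega),
      pd_frechet_of_lt t3 (t4.exists_C (by omega)) s2 (by omega),
      pd_frechet_subtop s4 (s4.exists_C (by omega)) t4 (by omega),
      pd_frechet_subtop t4 (t4.exists_C (by omega)) s4 (by omega), s6, t6, Dx_C, Dx_neg_Xx,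
      cast_eq]
    push_cast
    ring

theorem mem_vars_of_pderiv_ne_zero {i : Option (Bool × ℕ)} {P : A2} (h : pderiv i P ≠ 0) :
    i ∈ P.vars := by
  by_contra hi
  exact h (pderiv_eq_zero_of_notMem_vars hi)

theorem notMem_vars_of_pderiv_eq_zero {i : Option (Bool × ℕ)} {P : A2} (h : pderiv i P = 0) :
    i ∉ P.vars := by
  intro hi
  obtain ⟨s, hs, his⟩ := (mem_vars_iff_mem_support i).1 hi
  have hsi : 1 ≤ s i := Nat.one_le_iff_ne_zero.2 (Finsupp.mem_support_iff.1 his)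
  have h1 := coeff_pderiv (i := i) P (s - Finsupp.single i 1)
  rw [h, tsub_add_cancel_of_le (by simpa using hsi)] at h1
  have h2 : coeff s P ≠ 0 := mem_support_iff.1 hs
  have h3 : ((s i : ℕ) : ℂ) ≠ 0 := by exact_mod_cast Nat.one_le_iff_ne_zero.1 hsi
  simp [h2] at h1
  norm_cast at h1

theorem derivation_ofNat (D : Derivation ℂ A2 A2) (n : ℕ) [n.AtLeastTwo] :
    D (ofNat(n) : A2) = 0 := by
  exact D.map_natCast n

/-- The leading structure of the pair `-(x²w₁ + 2xw + const)`, `w = u, v`. -/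
structure IsProjective (f : A2 × A2) : Prop where
  orderLE_u : OrderLE false 1 f.1
  orderLE_v : OrderLE true 1 f.2
  pd_v_fst : ∀ k, pd true k f.1 = 0
  pd_u_snd : ∀ k, pd false k f.2 = 0
  pd_one_u : pd false 1 f.1 = -Xx ^ 2
  pd_one_v : pd true 1 f.2 = -Xx ^ 2
  pd_zero_u : pd false 0 f.1 = -(2 * Xx)
  pd_zero_v : pd true 0 f.2 = -(2 * Xx)

theorem Dx_neg_Xx_sq : Dx (-Xx ^ 2) = -(2 * Xx) := by
  simp [Dx_eq_totalDerivation, totalDerivation, Xx, Derivation.leibniz_pow]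

theorem IsProjective.lieBr2 {f K : A2 × A2} {e : ℂ} (hf : IsProjective f)
    (hK : IsTriangular 0 (C 1) K) (he : pd true 3 K.1 = C e) :
    IsTriangular 0 (-(6 * Xx)) (lieBr2 f K) := by
  obtain ⟨f1, f2, f3, f4, f5, f6, f7, f8⟩ := hf
  obtain ⟨k1, k2, k3, k4, k5, k6⟩ := hK
  simp only [zero_add] at k1 k2 k3 k4 k5 k6
  have c3 : ∀ b k, 3 ≤ k → ∃ c, pd b k K.1 = C c := by
    intro b k hk
    rcases (show k = 3 ∨ 3 < k by omega) with rfl | hk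
    · cases b
      exacts [⟨_, k5⟩, ⟨_, he⟩]
    · cases b
      exacts [k1.exists_C hk, k2.exists_C hk]
  have c4 : ∀ k, 3 ≤ k → ∃ c, pd true k K.2 = C c := by
    intro k hk
    rcases (show k = 3 ∨ 3 < k by omega) with rfl | hk
    exacts [⟨_, k6⟩, k4.exists_C hk]
  have z1 : ∀ k, ∃ c, pd true k f.1 = C c := fun k => ⟨0, by rw [f3, map_zero]⟩
  have z2 : ∀ k, ∃ c, pd false k f.2 = C c := fun k => ⟨0, by rw [f4, map_zero]⟩
  constructor
  · intro k hk
    rw [lieBr2_fst, map_sub, map_sub, map_add, frechet_eq_zero f3,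
      pd_frechet_eq_zero k2 (c3 _ _ (by omega)) f4]
    rcases (show 4 = k ∨ 4 < k by omega) with rfl | hk
    · rw [pd_frechet_top k1 (c3 _ _ (by omega)) f1 (by omega),
        pd_frechet_top f1 (f1.exists_C (by omega)) k1 (by omega), map_zero]
      ring
    · rw [pd_frechet_of_lt k1 (c3 _ _ (by omega)) f1 (by omega),
        pd_frechet_of_lt f1 (f1.exists_C (by omega)) k1 (by omega), map_zero]
      ring
  · intro k hk
    rw [lieBr2_fst, map_sub, map_sub, map_add, frechet_eq_zero f3,
      pd_frechet_eq_zero k1 (c3 _ _ (by omega)) f3]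
    rcases (show 4 = k ∨ 4 < k by omega) with rfl | hk
    · rw [pd_frechet_top k2 (c3 _ _ (by omega)) f2 (by omega),
        pd_frechet_top f1 (z1 _) k2 (by omega), map_zero, f5, f6]
      ring
    · rw [pd_frechet_of_lt k2 (c3 _ _ (by omega)) f2 (by omega),
        pd_frechet_of_lt f1 (z1 _) k2 (by omega), map_zero]
      ring
  · intro k hk
    rw [lieBr2_snd, map_sub, map_sub, map_add, frechet_eq_zero f4,
      pd_frechet_eq_zero k4 (k3.exists_C (by omega)) f4]
    rcases (show 2 = k ∨ 2 < k by omega) with rfl | hk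
    · rw [pd_frechet_top k3 (k3.exists_C (by omega)) f1 (by omega),
        pd_frechet_top f2 (z2 _) k3 (by omega), map_zero, f5, f6]
      ring
    · rw [pd_frechet_of_lt k3 (k3.exists_C (by omega)) f1 (by omega),
        pd_frechet_of_lt f2 (z2 _) k3 (by omega), map_zero]
      ring
  · intro k hk
    rw [lieBr2_snd, map_sub, map_sub, map_add, frechet_eq_zero f4,
      pd_frechet_eq_zero k3 (c4 _ (by omega)) f3]
    rcases (show 4 = k ∨ 4 < k by omega) with rfl | hk
    · rw [pd_frechet_top k4 (c4 _ (by omega)) f2 (by omega),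
        pd_frechet_top f2 (f2.exists_C (by omega)) k4 (by omega), map_zero]
      ring
    · rw [pd_frechet_of_lt k4 (c4 _ (by omega)) f2 (by omega),
        pd_frechet_of_lt f2 (f2.exists_C (by omega)) k4 (by omega), map_zero]
      ring
  · rw [lieBr2_fst, map_sub, map_sub, map_add, frechet_eq_zero f3, map_zero,
      pd_frechet_eq_zero k2 (c3 _ _ (by omega)) f4,
      pd_frechet_subtop k1 (c3 _ _ (by omega)) f1 (by omega),
      pd_frechet_subtop f1 (f1.exists_C (by omega)) k1 (by omega)]
    simp only [zero_add, f5, f7, k5, Dx_C, Dx_neg_Xx_sq]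
    rw [map_one]
    push_cast
    ring
  · rw [lieBr2_snd, map_sub, map_sub, map_add, frechet_eq_zero f4, map_zero,
      pd_frechet_eq_zero k3 (c4 _ (by omega)) f3,
      pd_frechet_subtop k4 (c4 _ (by omega)) f2 (by omega),
      pd_frechet_subtop f2 (f2.exists_C (by omega)) k4 (by omega)]
    simp only [zero_add, f6, f8, k6, Dx_C, Dx_neg_Xx_sq]
    rw [map_one]
    push_cast
    ring

theorem IsTriangular.smul {l : ℕ} {c : A2} {S : A2 × A2} (h : IsTriangular l c S) (a : ℂ) :
    IsTriangular l (a • c) (a • S) where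
  orderLE_uu k hk := by simp [h.orderLE_uu k hk]
  orderLE_uv k hk := by simp [h.orderLE_uv k hk]
  orderLE_vu k hk := by simp [h.orderLE_vu k hk]
  orderLE_vv k hk := by simp [h.orderLE_vv k hk]
  pd_uu := by simp [h.pd_uu]
  pd_vv := by simp [h.pd_vv]

theorem IsTriangular.iterate_lieBr2 {T S : A2 × A2} {c : ℂ} (hT : IsTriangular 0 (-Xx) T)
    (hS : IsTriangular 0 (C c) S) (hc : c ≠ 0) (n : ℕ) :
    ∃ d : ℂ, d ≠ 0 ∧ IsTriangular (2 * n) (C d) ((fun R => _root_.lieBr2 T R)^[n] S) := by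
  induction n with
  | zero => exact ⟨c, hc, hS⟩
  | succ n ih =>
    obtain ⟨d, hd, h⟩ := ih
    rw [Function.iterate_succ_apply']
    refine ⟨_, mul_ne_zero (neg_ne_zero.2 ?_) hd, hT.lieBr2 h⟩
    exact_mod_cast (show 2 * n + 3 ≠ 0 by omega)

theorem isProjective_point_symmetry (γ : ℂ) : IsProjective
    (-(Xx ^ 2 * U 1 + 2 * Xx * U 0 - 1), -(Xx ^ 2 * V 1 + 2 * Xx * V 0 + C γ)) := by
  constructor <;> (try rintro k hk) <;> (try obtain ⟨k, rfl⟩ := Nat.exists_eq_add_of_lt hk) <;>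
  simp [Xx, U, V, pderiv_X, Derivation.leibniz_pow, derivation_ofNat]

theorem isTriangular_system12 (ε : ℂ) : IsTriangular 0 (C 1)
    (B3 + 2 * C ε * Dx (V 2 + 3 * U 0 * V 1 + 2 * V 0 * U 1 + 2 * U 0 ^ 2 * V 0),
      V 3 + 3 * U 0 * V 2 + 6 * U 1 * V 1 + 3 * U 0 ^ 2 * V 1 -
        C ε * (4 * V 0 * V 2 - V 1 ^ 2 + 8 * U 1 * V 0 ^ 2 + 8 * U 0 * V 0 * V 1 +
          4 * U 0 ^ 2 * V 0 ^ 2)) := by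
  have h1 : ∀ k, 3 + k ≠ 1 := by omega
  have h2 : ∀ k, 3 + k ≠ 2 := by omega
  rw [Dx_eq_totalDerivation]
  constructor <;> (try rintro k hk) <;> (try obtain ⟨k, rfl⟩ := Nat.exists_eq_add_of_lt hk) <;>
  simp [B3, totalDerivation, U, V, pderiv_X, Derivation.leibniz_pow,
    derivation_ofNat, h1, h2]

theorem pd_three_system12 (ε : ℂ) : pd true 3
    (B3 + 2 * C ε * Dx (V 2 + 3 * U 0 * V 1 + 2 * V 0 * U 1 + 2 * U 0 ^ 2 * V 0)) =
      C (2 * ε) := by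
  have : C (2 : ℂ) = (2 : A2) := map_ofNat C 2
  rw [Dx_eq_totalDerivation]
  simp [B3, totalDerivation, U, V, pderiv_X, Derivation.leibniz_pow, derivation_ofNat,
    this]

/-- For System (12) with master symmetry `τ = (1/6)[f,K]`, the iterated adjoint
`ad_τⁿ K` is a pair of differential polynomials of order exactly `3 + 2n`: it
depends on the variables `u_{3+2n}`, `v_{3+2n}`, but on no `u_k`, `v_k` with
`k > 3 + 2n`. -/
theorem system12_symmetry_orders (ε γ : ℂ) :
    let K : A2 × A2 :=
      (B3 + 2 * C ε * Dx (V 2 + 3 * U 0 * V 1 + 2 * V 0 * U 1 + 2 * U 0 ^ 2 * V 0),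
       V 3 + 3 * U 0 * V 2 + 6 * U 1 * V 1 + 3 * U 0 ^ 2 * V 1 -
         C ε * (4 * V 0 * V 2 - V 1 ^ 2 + 8 * U 1 * V 0 ^ 2 + 8 * U 0 * V 0 * V 1 +
           4 * U 0 ^ 2 * V 0 ^ 2))
    let τ : A2 × A2 := (1 / 6 : ℂ) •
      lieBr2 (-(Xx ^ 2 * U 1 + 2 * Xx * U 0 - 1), -(Xx ^ 2 * V 1 + 2 * Xx * V 0 + C γ)) K
    ∀ n : ℕ,
      some (false, 3 + 2 * n) ∈
          ((fun S => lieBr2 τ S)^[n] K).1.vars ∪ ((fun S => lieBr2 τ S)^[n] K).2.vars ∧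
      some (true, 3 + 2 * n) ∈
          ((fun S => lieBr2 τ S)^[n] K).1.vars ∪ ((fun S => lieBr2 τ S)^[n] K).2.vars ∧
      ∀ k : ℕ, 3 + 2 * n < k →
        some (false, k) ∉
            ((fun S => lieBr2 τ S)^[n] K).1.vars ∪ ((fun S => lieBr2 τ S)^[n] K).2.vars ∧
        some (true, k) ∉
            ((fun S => lieBr2 τ S)^[n] K).1.vars ∪ ((fun S => lieBr2 τ S)^[n] K).2.vars := by
  intro K τ n
  have hK : IsTriangular 0 (C 1) K := isTriangular_system12 ε
  have hτ : IsTriangular 0 (-Xx) τ := by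
    have h := ((isProjective_point_symmetry γ).lieBr2 hK (pd_three_system12 ε)).smul (1 / 6)
    have h6 : C (1 / 6 : ℂ) * 6 = (1 : A2) := by
      rw [← map_ofNat C 6, ← map_mul]
      norm_num
    have hx : (1 / 6 : ℂ) • -(6 * Xx) = -Xx := by
      rw [smul_eq_C_mul]
      linear_combination -Xx * h6
    rwa [hx] at h
  obtain ⟨d, hd, h⟩ := hτ.iterate_lieBr2 hK one_ne_zero n
  have hd : (C d : A2) ≠ 0 := C_ne_zero.2 hd
  simp only [Finset.mem_union, not_or, add_comm 3 (2 * n)]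
  refine ⟨.inl (mem_vars_of_pderiv_ne_zero ?_), .inr (mem_vars_of_pderiv_ne_zero ?_),
    fun k hk => ⟨⟨?_, ?_⟩, ?_, ?_⟩⟩
  · rwa [h.pd_uu]
  · rwa [h.pd_vv]
  · exact notMem_vars_of_pderiv_eq_zero (h.orderLE_uu k hk)
  · exact notMem_vars_of_pderiv_eq_zero (h.orderLE_vu k (by omega))
  · exact notMem_vars_of_pderiv_eq_zero (h.orderLE_uv k hk)
  · exact notMem_vars_of_pderiv_eq_zero (h.orderLE_vv k hk)
end

section
/- Let ε ∈ ℂ and let K be the pair K¹ = B₃[u] + 3ε D_x(v₂ − v u₁) + 3ε²(4v v₂ + 3v₁² − v²u₁) + 12ε³ v²v₁, K² = v₃ − 3 D_x(u v₁ − u²v) + 3ε(3v v₂ + 3v₁² − 2 D_x(v²u)) + 21ε² v²v₁. Set f = −(x²u₁ + 2xu + 1, x²v₁ + 2xv) and τ = (1/6)[f, K]. Then [τ,K] ≠ 0 and [[τ,K],K] = 0; hence τ is a master symmetry of the system u_t = K¹, v_t = K². -/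
open MvPolynomial

/-- For injective `i`, the sum of `∂P/∂X_{i k} * F k` over `k` is the derivation of the polynomial
ring sending `X_{i k}` to `F k` and every other variable to `0`. -/
theorem finsum_pderiv_mul {R σ κ : Type*} [CommRing R] {i : κ → σ} (hi : Function.Injective i)
    (F : κ → MvPolynomial σ R) (P : MvPolynomial σ R) :
    (Function.HasFiniteSupport fun k => pderiv (i k) P * F k) ∧
      ∑ᶠ k, pderiv (i k) P * F k = mkDerivation R (Function.extend i F 0) P := by
  classical
  have hfin (Q : MvPolynomial σ R) (G : κ → MvPolynomial σ R) :
      Function.HasFiniteSupport fun k => pderiv (i k) Q * G k := by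
    refine (Q.vars.finite_toSet.preimage hi.injOn).subset fun k hk => ?_
    by_contra hmem
    exact hk (by simp [pderiv_eq_zero_of_notMem_vars (show i k ∉ Q.vars from hmem)])
  refine ⟨hfin P F, ?_⟩
  induction P using MvPolynomial.induction_on with
  | C a => simp
  | add p q hp hq =>
    simp only [map_add, add_mul]
    rw [finsum_add_distrib (hfin p F) (hfin q F), hp, hq]
  | mul_X p n hp =>
    have hX : ∑ᶠ k, pderiv (i k) (X n : MvPolynomial σ R) * F k = Function.extend i F 0 n := by
      by_cases hn : ∃ k, i k = n
      · obtain ⟨k, rfl⟩ := hn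
        rw [finsum_eq_single _ k fun j hj => by
          rw [pderiv_X_of_ne (hi.ne hj.symm), zero_mul], hi.extend_apply, pderiv_X_self, one_mul]
      · rw [Function.extend_apply' _ _ _ hn]
        refine finsum_eq_zero_of_forall_eq_zero fun k => ?_
        rw [pderiv_X_of_ne fun h => hn ⟨k, h.symm⟩, zero_mul]
    have hsplit (k : κ) : pderiv (i k) (p * X n) * F k =
        p * (pderiv (i k) (X n) * F k) + X n * (pderiv (i k) p * F k) := by
      rw [pderiv_mul]; ring
    have hp' : Function.HasFiniteSupport fun k => p * (pderiv (i k) (X n) * F k) := by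
      convert hfin (X n) fun k => p * F k using 2; ring
    have hn' : Function.HasFiniteSupport fun k => X n * (pderiv (i k) p * F k) := by
      convert hfin p fun k => X n * F k using 2; ring
    rw [finsum_congr hsplit, finsum_add_distrib hp' hn', ← mul_finsum' _ _ (hfin (X n) F),
      ← mul_finsum' _ _ (hfin p F), hX, hp, Derivation.leibniz, mkDerivation_X, smul_eq_mul,
      smul_eq_mul]

theorem mkDerivation_add {R σ : Type*} [CommRing R] (F G : σ → MvPolynomial σ R) :
    mkDerivation R (F + G) = mkDerivation R F + mkDerivation R G :=
  derivation_ext fun n => by simp [mkDerivation_X]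

theorem jet_injective (b : Bool) :
    Function.Injective fun k : ℕ => (some (b, k) : Option (Bool × ℕ)) :=
  fun _ _ h => by simpa using h

theorem extend_jet (b c : Bool) (F : ℕ → A2) (k : ℕ) :
    Function.extend (fun k : ℕ => (some (b, k) : Option (Bool × ℕ))) F 0 (some (c, k)) =
      if c = b then F k else 0 := by
  split_ifs with h
  · subst h; exact (jet_injective c).extend_apply F 0 k
  · exact Function.extend_apply' _ _ _ fun ⟨j, hj⟩ => h (by simp_all)

/-- The total derivative as a derivation. -/
noncomputable def totalDeriv : Derivation ℂ A2 A2 :=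
  mkDerivation ℂ fun
    | none => 1
    | some (false, k) => U (k + 1)
    | some (true, k) => V (k + 1)

theorem Dx_eq_totalDeriv : Dx = totalDeriv := by
  funext P
  have hu := finsum_pderiv_mul (jet_injective false) (fun k => U (k + 1)) P
  have hv := finsum_pderiv_mul (jet_injective true) (fun k => V (k + 1)) P
  simp only [Dx, mul_comm (U _), mul_comm (V _)]
  rw [finsum_add_distrib hu.1 hv.1, hu.2, hv.2, pderiv_def, ← Derivation.add_apply,
    ← Derivation.add_apply, ← mkDerivation_add, ← mkDerivation_add, totalDeriv]
  congr 2
  funext n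
  rcases n with _ | ⟨_ | _, k⟩ <;> simp [extend_jet]

/-- The evolutionary derivation with characteristic `P`: it commutes with the total derivative and
sends `u` to `P.1` and `v` to `P.2`. -/
noncomputable def evolDeriv (P : A2 × A2) : Derivation ℂ A2 A2 :=
  mkDerivation ℂ fun
    | none => 0
    | some (false, k) => totalDeriv^[k] P.1
    | some (true, k) => totalDeriv^[k] P.2

theorem frU_add_frV (Q : A2) (P : A2 × A2) : frU Q P.1 + frV Q P.2 = evolDeriv P Q := by
  rw [frU, frV, (finsum_pderiv_mul (jet_injective false) _ Q).2,
    (finsum_pderiv_mul (jet_injective true) _ Q).2, ← Derivation.add_apply, ← mkDerivation_add,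
    evolDeriv, Dx_eq_totalDeriv]
  congr 2
  funext n
  rcases n with _ | ⟨_ | _, k⟩ <;> simp [extend_jet]

theorem lieBr2_eq_evolDeriv (P J : A2 × A2) :
    lieBr2 P J = (evolDeriv P J.1 - evolDeriv J P.1, evolDeriv P J.2 - evolDeriv J P.2) := by
  simp only [lieBr2, sub_sub, frU_add_frV]

theorem iterate_totalDeriv_smul (k : ℕ) (c : ℂ) (P : A2) :
    totalDeriv^[k] (c • P) = c • totalDeriv^[k] P :=
  Function.Commute.iterate_left (fun P => totalDeriv.map_smul c P) k P

theorem evolDeriv_smul (c : ℂ) (P : A2 × A2) : evolDeriv (c • P) = c • evolDeriv P :=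
  derivation_ext fun n => by
    rcases n with _ | ⟨_ | _, k⟩ <;> simp [evolDeriv, mkDerivation_X, iterate_totalDeriv_smul]

theorem lieBr2_smul_left (c : ℂ) (P J : A2 × A2) : lieBr2 (c • P) J = c • lieBr2 P J := by
  simp [lieBr2_eq_evolDeriv, evolDeriv_smul, smul_sub]

theorem Dx_eq_iterate_totalDeriv (P : A2) : Dx P = totalDeriv^[1] P := by
  rw [Dx_eq_totalDeriv, Function.iterate_one]

section JetRules

variable (k n : ℕ) (P Q : A2) (c : ℂ) (W : A2 × A2)

theorem iterate_totalDeriv_add :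
    totalDeriv^[k] (P + Q) = totalDeriv^[k] P + totalDeriv^[k] Q :=
  iterate_map_add totalDeriv k P Q

theorem iterate_totalDeriv_sub :
    totalDeriv^[k] (P - Q) = totalDeriv^[k] P - totalDeriv^[k] Q :=
  iterate_map_sub totalDeriv k P Q

theorem iterate_totalDeriv_neg : totalDeriv^[k] (-P) = -totalDeriv^[k] P :=
  iterate_map_neg totalDeriv k P

/-- The general Leibniz rule for the total derivative. -/
theorem iterate_totalDeriv_mul :
    totalDeriv^[k] (P * Q) = ∑ i ∈ Finset.range (k + 1),
      (k.choose i : A2) * totalDeriv^[i] P * totalDeriv^[k - i] Q := by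
  have key : totalDeriv^[k] (P * Q) = ∑ ij ∈ Finset.HasAntidiagonal.antidiagonal k,
      k.choose ij.1 • (totalDeriv^[ij.1] P * totalDeriv^[ij.2] Q) := by
    induction k with
    | zero => simp
    | succ k ih =>
      rw [Finset.sum_antidiagonal_choose_succ_nsmul
        (fun i j => totalDeriv^[i] P * totalDeriv^[j] Q) k]
      simp only [Function.iterate_succ_apply', ih, map_sum, map_nsmul, Derivation.leibniz,
        smul_eq_mul, smul_add, Finset.sum_add_distrib, add_right_inj]
      refine Finset.sum_congr rfl fun ⟨i, j⟩ hij => ?_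
      rw [k.choose_symm_of_eq_add (Finset.HasAntidiagonal.mem_antidiagonal.1 hij).symm, mul_comm]
  rw [key, Finset.Nat.sum_antidiagonal_eq_sum_range_succ
    (fun i j => k.choose i • (totalDeriv^[i] P * totalDeriv^[j] Q)) k]
  simp only [nsmul_eq_mul, mul_assoc]

theorem iterate_totalDeriv_mul_of_le_five :
    totalDeriv^[1] (P * Q) = P * totalDeriv^[1] Q + totalDeriv^[1] P * Q ∧
    totalDeriv^[2] (P * Q) = P * totalDeriv^[2] Q + 2 * totalDeriv^[1] P * totalDeriv^[1] Q +
      totalDeriv^[2] P * Q ∧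
    totalDeriv^[3] (P * Q) = P * totalDeriv^[3] Q + 3 * totalDeriv^[1] P * totalDeriv^[2] Q +
      3 * totalDeriv^[2] P * totalDeriv^[1] Q + totalDeriv^[3] P * Q ∧
    totalDeriv^[4] (P * Q) = P * totalDeriv^[4] Q + 4 * totalDeriv^[1] P * totalDeriv^[3] Q +
      6 * totalDeriv^[2] P * totalDeriv^[2] Q + 4 * totalDeriv^[3] P * totalDeriv^[1] Q +
      totalDeriv^[4] P * Q ∧
    totalDeriv^[5] (P * Q) = P * totalDeriv^[5] Q + 5 * totalDeriv^[1] P * totalDeriv^[4] Q +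
      10 * totalDeriv^[2] P * totalDeriv^[3] Q + 10 * totalDeriv^[3] P * totalDeriv^[2] Q +
      5 * totalDeriv^[4] P * totalDeriv^[1] Q + totalDeriv^[5] P * Q := by
  refine ⟨?_, ?_, ?_, ?_, ?_⟩ <;>
    simp only [iterate_totalDeriv_mul, Finset.sum_range_succ, Finset.sum_range_zero, Nat.choose,
      Nat.reduceAdd, Nat.reduceSub, Nat.cast_one, Nat.cast_ofNat, Function.iterate_zero_apply,
      zero_add, one_mul]

theorem iterate_totalDeriv_U : totalDeriv^[k] (U n) = U (n + k) := by
  induction k with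
  | zero => rfl
  | succ k ih => rw [Function.iterate_succ_apply', ih, totalDeriv, U, mkDerivation_X]; rfl

theorem iterate_totalDeriv_V : totalDeriv^[k] (V n) = V (n + k) := by
  induction k with
  | zero => rfl
  | succ k ih => rw [Function.iterate_succ_apply', ih, totalDeriv, V, mkDerivation_X]; rfl

theorem iterate_succ_totalDeriv_C : totalDeriv^[k + 1] (C c) = 0 := by
  rw [Function.iterate_succ_apply, derivation_C]
  exact iterate_map_zero totalDeriv k

theorem iterate_succ_totalDeriv_ofNat [n.AtLeastTwo] :
    totalDeriv^[k + 1] (ofNat(n) : A2) = 0 := by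
  rw [← map_ofNat C n]
  exact iterate_succ_totalDeriv_C k _

theorem iterate_succ_totalDeriv_one : totalDeriv^[k + 1] (1 : A2) = 0 :=
  iterate_succ_totalDeriv_C k 1

theorem totalDeriv_Xx : totalDeriv Xx = 1 := mkDerivation_X _ _ _

theorem iterate_one_totalDeriv_Xx : totalDeriv^[1] Xx = 1 := mkDerivation_X _ _ _

theorem iterate_totalDeriv_Xx : totalDeriv^[k + 2] Xx = 0 := by
  rw [Function.iterate_succ_apply, totalDeriv_Xx]
  exact iterate_succ_totalDeriv_one k

theorem evolDeriv_U : evolDeriv W (U k) = totalDeriv^[k] W.1 := mkDerivation_X _ _ _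

theorem evolDeriv_V : evolDeriv W (V k) = totalDeriv^[k] W.2 := mkDerivation_X _ _ _

theorem evolDeriv_Xx : evolDeriv W Xx = 0 := mkDerivation_X _ _ _

theorem evolDeriv_C : evolDeriv W (C c) = 0 := derivation_C _ _

theorem evolDeriv_ofNat [n.AtLeastTwo] : evolDeriv W (ofNat(n) : A2) = 0 :=
  (evolDeriv W).map_natCast n

end JetRules

/-- The right-hand side of System (14), expanded. -/
noncomputable def thirdOrderFlow (ε : ℂ) : A2 × A2 :=
  (U 3 + 3 * U 0 * U 2 + 3 * U 0 ^ 2 * U 1 + 3 * U 1 ^ 2 +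
    C ε * (3 * V 3 - 3 * U 2 * V 0 - 3 * U 1 * V 1) +
    C (ε ^ 2) * (12 * V 0 * V 2 - 3 * U 1 * V 0 ^ 2 + 9 * V 1 ^ 2) +
    C (ε ^ 3) * (12 * V 0 ^ 2 * V 1),
   V 3 - 3 * U 0 * V 2 - 3 * U 1 * V 1 + 6 * U 0 * U 1 * V 0 + 3 * U 0 ^ 2 * V 1 +
    C ε * (9 * V 0 * V 2 - 12 * U 0 * V 0 * V 1 - 6 * U 1 * V 0 ^ 2 + 9 * V 1 ^ 2) +
    C (ε ^ 2) * (21 * V 0 ^ 2 * V 1))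

set_option maxHeartbeats 2000000 in
/-- The fifth-order symmetry of System (14). -/
noncomputable def fifthOrderFlow (ε : ℂ) : A2 × A2 :=
  (U 5 + 5 * U 0 * U 4 + 15 * U 1 * U 3 + 10 * U 0 ^ 2 * U 3 + 50 * U 0 * U 1 * U 2 + 10 *
      U 0 ^ 3 * U 2 + 10 * U 2 ^ 2 + 5 * U 0 ^ 4 * U 1 + 30 * U 0 ^ 2 * U 1 ^ 2 + 15 * U 1 ^ 3 +
    C ε * (5 * V 5 - 5 * U 4 * V 0 - 10 * U 1 * V 3 - 15 * U 3 * V 1 + 10 * U 0 ^ 2 * V 3 - 20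
      * U 2 * V 2 + 40 * U 0 * U 1 * V 2 + 20 * U 0 * U 2 * V 1 - 10 * U 0 ^ 2 * U 2 * V 0 - 10
      * U 0 ^ 2 * U 1 * V 1 + 20 * U 1 ^ 2 * V 1 - 20 * U 0 * U 1 ^ 2 * V 0) +
    C (ε ^ 2) * (30 * V 0 * V 4 + 120 * V 1 * V 3 - 20 * U 0 * V 0 * V 3 - 10 * U 3 * V 0 ^ 2
      - 80 * U 1 * V 0 * V 2 - 70 * U 2 * V 0 * V 1 - 40 * U 0 * V 1 * V 2 + 40 * U 0 ^ 2 * V 0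
      * V 2 + 30 * U 0 * U 2 * V 0 ^ 2 + 95 * V 2 ^ 2 + 140 * U 0 * U 1 * V 0 * V 1 - 60 * U 1 *
      V 1 ^ 2 - 10 * U 0 ^ 2 * U 1 * V 0 ^ 2 + 30 * U 0 ^ 2 * V 1 ^ 2 + 30 * U 1 ^ 2 * V 0 ^ 2)
      +
    C (ε ^ 3) * (90 * V 0 ^ 2 * V 3 + 540 * V 0 * V 1 * V 2 - 80 * U 0 * V 0 ^ 2 * V 2 - 30 *
      U 2 * V 0 ^ 3 - 190 * U 1 * V 0 ^ 2 * V 1 + 40 * U 0 ^ 2 * V 0 ^ 2 * V 1 - 120 * U 0 * V 0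
      * V 1 ^ 2 + 40 * U 0 * U 1 * V 0 ^ 3 + 150 * V 1 ^ 3) +
    C (ε ^ 4) * (160 * V 0 ^ 3 * V 2 - 80 * U 0 * V 0 ^ 3 * V 1 + 450 * V 0 ^ 2 * V 1 ^ 2 - 35
      * U 1 * V 0 ^ 4) +
    C (ε ^ 5) * (120 * V 0 ^ 4 * V 1),
   V 5 - 5 * U 0 * V 4 - 10 * U 1 * V 3 - 5 * U 3 * V 1 + 10 * U 0 * U 3 * V 0 + 10 * U 0 ^ 2
      * V 3 - 10 * U 2 * V 2 + 20 * U 0 * U 2 * V 1 + 20 * U 1 * U 2 * V 0 + 30 * U 0 * U 1 *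
      V 2 - 10 * U 0 ^ 3 * V 2 - 30 * U 0 ^ 2 * U 1 * V 1 + 15 * U 1 ^ 2 * V 1 + 20 * U 0 ^ 3 *
      U 1 * V 0 + 5 * U 0 ^ 4 * V 1 +
    C ε * (15 * V 0 * V 4 + 40 * V 1 * V 3 - 40 * U 0 * V 0 * V 3 - 10 * U 3 * V 0 ^ 2 - 50 *
      U 2 * V 0 * V 1 - 120 * U 0 * V 1 * V 2 - 70 * U 1 * V 0 * V 2 + 20 * U 0 * U 2 * V 0 ^ 2
      + 70 * U 0 ^ 2 * V 0 * V 2 + 25 * V 2 ^ 2 + 180 * U 0 * U 1 * V 0 * V 1 - 70 * U 1 *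
      V 1 ^ 2 - 60 * U 0 ^ 2 * U 1 * V 0 ^ 2 - 40 * U 0 ^ 3 * V 0 * V 1 + 20 * U 1 ^ 2 * V 0 ^ 2
      + 70 * U 0 ^ 2 * V 1 ^ 2) +
    C (ε ^ 2) * (70 * V 0 ^ 2 * V 3 + 360 * V 0 * V 1 * V 2 - 150 * U 0 * V 0 ^ 2 * V 2 - 20 *
      U 2 * V 0 ^ 3 - 210 * U 1 * V 0 ^ 2 * V 1 - 300 * U 0 * V 0 * V 1 ^ 2 + 100 * U 0 * U 1 *
      V 0 ^ 3 + 150 * U 0 ^ 2 * V 0 ^ 2 * V 1 + 110 * V 1 ^ 3) +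
    C (ε ^ 3) * (170 * V 0 ^ 3 * V 2 - 240 * U 0 * V 0 ^ 3 * V 1 + 510 * V 0 ^ 2 * V 1 ^ 2 -
      60 * U 1 * V 0 ^ 4) +
    C (ε ^ 4) * (205 * V 0 ^ 4 * V 1))

/-- Six times the master symmetry of System (14), up to sign. -/
noncomputable def masterSymm (ε : ℂ) : A2 × A2 :=
  (6 * Xx * (thirdOrderFlow ε).1 + 15 * U 2 + 36 * U 0 * U 1 + 6 * U 0 ^ 3 +
    C ε * (36 * V 2 - 6 * U 0 * V 1 - 24 * U 1 * V 0) +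
    C (ε ^ 2) * (108 * V 0 * V 1 - 6 * U 0 * V 0 ^ 2) +
    C (ε ^ 3) * (24 * V 0 ^ 3),
   6 * Xx * (thirdOrderFlow ε).2 + 9 * V 2 - 18 * U 0 * V 1 + 18 * U 0 ^ 2 * V 0 +
    C ε * (78 * V 0 * V 1 - 36 * U 0 * V 0 ^ 2) +
    C (ε ^ 2) * (42 * V 0 ^ 3))

theorem lieBr2_thirdOrderFlow (ε : ℂ) :
    lieBr2 (-(Xx ^ 2 * U 1 + 2 * Xx * U 0 + 1), -(Xx ^ 2 * V 1 + 2 * Xx * V 0))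
      (thirdOrderFlow ε) = -masterSymm ε := by
  rw [lieBr2_eq_evolDeriv]
  ext1 <;> simp (maxSteps := 2000000) only [
    thirdOrderFlow, masterSymm, Prod.neg_mk, pow_succ, pow_zero, one_mul,
    map_add, map_sub, map_neg, Derivation.leibniz, Derivation.map_one_eq_zero, smul_eq_mul,
    evolDeriv_U, evolDeriv_V, evolDeriv_C, evolDeriv_ofNat, evolDeriv_Xx,
    Function.iterate_zero_apply, iterate_totalDeriv_add, iterate_totalDeriv_sub,
    iterate_totalDeriv_neg, iterate_totalDeriv_mul_of_le_five, iterate_totalDeriv_U,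
    iterate_totalDeriv_V, iterate_succ_totalDeriv_C, iterate_succ_totalDeriv_ofNat, iterate_succ_totalDeriv_one,
    iterate_one_totalDeriv_Xx, iterate_totalDeriv_Xx, mul_zero, zero_mul, add_zero, zero_add,
    Nat.reduceAdd, C_mul]
  · ring
  · ring

set_option maxHeartbeats 4000000 in
theorem lieBr2_masterSymm_thirdOrderFlow (ε : ℂ) :
    lieBr2 (masterSymm ε) (thirdOrderFlow ε) = (18 : ℂ) • fifthOrderFlow ε := by
  rw [lieBr2_eq_evolDeriv]
  ext1 <;> simp (maxSteps := 2000000) only [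
    thirdOrderFlow, masterSymm, fifthOrderFlow,
    Prod.smul_fst, Prod.smul_snd, smul_eq_C_mul, map_ofNat, pow_succ, pow_zero, one_mul,
    map_add, map_sub, Derivation.leibniz, smul_eq_mul,
    evolDeriv_U, evolDeriv_V, evolDeriv_C, evolDeriv_ofNat, evolDeriv_Xx,
    Function.iterate_zero_apply, iterate_totalDeriv_add, iterate_totalDeriv_sub,
    iterate_totalDeriv_mul_of_le_five, iterate_totalDeriv_U, iterate_totalDeriv_V,
    iterate_succ_totalDeriv_C, iterate_succ_totalDeriv_ofNat,
    iterate_one_totalDeriv_Xx, iterate_totalDeriv_Xx, mul_zero, zero_mul, add_zero, zero_add,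
    Nat.reduceAdd, C_mul]
  · ring
  · ring

set_option maxHeartbeats 40000000 in
theorem lieBr2_fifthOrderFlow_thirdOrderFlow (ε : ℂ) :
    lieBr2 (fifthOrderFlow ε) (thirdOrderFlow ε) = 0 := by
  rw [lieBr2_eq_evolDeriv]
  ext1 <;> simp (maxSteps := 2000000) only [
    thirdOrderFlow, fifthOrderFlow, Prod.fst_zero, Prod.snd_zero,
    pow_succ, pow_zero, one_mul,
    map_add, map_sub, Derivation.leibniz, smul_eq_mul,
    evolDeriv_U, evolDeriv_V, evolDeriv_C, evolDeriv_ofNat,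
    Function.iterate_zero_apply, iterate_totalDeriv_add, iterate_totalDeriv_sub,
    iterate_totalDeriv_mul_of_le_five, iterate_totalDeriv_U, iterate_totalDeriv_V,
    iterate_succ_totalDeriv_C, iterate_succ_totalDeriv_ofNat,
    mul_zero, zero_mul, add_zero, zero_add,
    Nat.reduceAdd, C_mul]
  · ring
  · ring

theorem fifthOrderFlow_ne_zero (ε : ℂ) : fifthOrderFlow ε ≠ 0 := fun h => by
  have := congrArg (fun P : A2 × A2 => eval (Pi.single (some (false, 5)) 1) P.1) h
  simp [fifthOrderFlow, U, V] at this

/-- With `f = −(x²u₁ + 2xu + 1, x²v₁ + 2xv)`, the pair `τ = (1/6)[f,K]` is a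
master symmetry of System (14): `[τ,K] ≠ 0` and `[[τ,K],K] = 0`. -/
theorem system14_master_symmetry (ε : ℂ) :
    let K : A2 × A2 :=
      (B3 + 3 * C ε * Dx (V 2 - V 0 * U 1) +
         3 * C (ε ^ 2) * (4 * V 0 * V 2 + 3 * V 1 ^ 2 - V 0 ^ 2 * U 1) +
         12 * C (ε ^ 3) * V 0 ^ 2 * V 1,
       V 3 - 3 * Dx (U 0 * V 1 - U 0 ^ 2 * V 0) +
         3 * C ε * (3 * V 0 * V 2 + 3 * V 1 ^ 2 - 2 * Dx (V 0 ^ 2 * U 0)) +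
         21 * C (ε ^ 2) * V 0 ^ 2 * V 1)
    let f : A2 × A2 :=
      (-(Xx ^ 2 * U 1 + 2 * Xx * U 0 + 1), -(Xx ^ 2 * V 1 + 2 * Xx * V 0))
    let τ : A2 × A2 := (1 / 6 : ℂ) • lieBr2 f K
    lieBr2 τ K ≠ 0 ∧ lieBr2 (lieBr2 τ K) K = 0 := by
  intro K f τ
  have hK : K = thirdOrderFlow ε := by
    simp only [K, B3, thirdOrderFlow, Dx_eq_iterate_totalDeriv, pow_succ, pow_zero, one_mul,
      iterate_totalDeriv_sub, iterate_totalDeriv_mul_of_le_five, iterate_totalDeriv_U,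
      iterate_totalDeriv_V, zero_add, Nat.reduceAdd]
    ext1
    · ring
    · ring
  have hτ : τ = (-1 / 6 : ℂ) • masterSymm ε := by
    rw [show τ = (1 / 6 : ℂ) • lieBr2 f K from rfl, hK, lieBr2_thirdOrderFlow]
    module
  have hbr : lieBr2 τ K = (-3 : ℂ) • fifthOrderFlow ε := by
    rw [hτ, hK, lieBr2_smul_left, lieBr2_masterSymm_thirdOrderFlow]
    module
  rw [hbr, lieBr2_smul_left, hK, lieBr2_fifthOrderFlow_thirdOrderFlow, smul_zero]
  exact ⟨smul_ne_zero (by norm_num) (fifthOrderFlow_ne_zero ε), rfl⟩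
end
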